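/- arXiv:1603.02304 — 2 statements merged into one kernel-verified Lean document; each statement's English description precedes it below -/
import Mathlib

section
/- Let n ∈ ℤ, λ ∈ ℂ, and let f: (0,1) → ℂ be twice differentiable. Define g on the punctured open unit disk of ℝ² by g(x,y) = f(ρ)·e^{inσ}, where (ρ,σ) are polar coordinates of (x,y) with 0 < ρ < 1. Then g satisfies ((1-x²-y²)/4)·(∂²g/∂x² + ∂²g/∂y²) + λ·g = 0 on the punctured open unit disk if and only if f satisfies the ordinary differential equation ρ²(1-ρ²)f″(ρ) + ρ(1-ρ²)f′(ρ) + (4λρ² - n²(1-ρ²))f(ρ) = 0 for all ρ ∈ (0,1). -/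
/-- The separated function `g(x,y) = f(ρ)e^{inσ}` where `(ρ,σ)` are polar coordinates of
`(x,y)`: here `e^{inσ} = ((x+iy)/ρ)^n`, which is well defined away from the origin. -/
noncomputable def polarSep (n : ℤ) (f : ℝ → ℂ) (x y : ℝ) : ℂ :=
  f (Real.sqrt (x ^ 2 + y ^ 2)) *
    (((x : ℂ) + (y : ℂ) * Complex.I) / ((Real.sqrt (x ^ 2 + y ^ 2) : ℝ) : ℂ)) ^ n

section helpers

variable {X Y : ℝ → ℝ} {p q : ℝ}

lemma hd_r (hX : ∀ t, HasDerivAt X p t) (hY : ∀ t, HasDerivAt Y q t) (t : ℝ)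
    (h0 : 0 < X t ^ 2 + Y t ^ 2) :
    HasDerivAt (fun t => Real.sqrt (X t ^ 2 + Y t ^ 2))
      ((p * X t + q * Y t) / Real.sqrt (X t ^ 2 + Y t ^ 2)) t := by
  have h := (((hX t).pow 2).add ((hY t).pow 2)).sqrt (by simpa using h0.ne')
  have hr : Real.sqrt (X t ^ 2 + Y t ^ 2) ≠ 0 := (Real.sqrt_pos.2 h0).ne'
  refine h.congr_deriv ?_
  simp only [Pi.add_apply, Pi.pow_apply]
  field_simp
  push_cast
  ring

lemma hd_u (n : ℤ) (hX : ∀ t, HasDerivAt X p t) (hY : ∀ t, HasDerivAt Y q t) (t : ℝ)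
    (h0 : 0 < X t ^ 2 + Y t ^ 2) :
    HasDerivAt (fun t => (((X t : ℂ) + (Y t : ℂ) * Complex.I) /
        ((Real.sqrt (X t ^ 2 + Y t ^ 2) : ℝ) : ℂ)) ^ n)
      ((((X t : ℂ) + (Y t : ℂ) * Complex.I) /
        ((Real.sqrt (X t ^ 2 + Y t ^ 2) : ℝ) : ℂ)) ^ n *
        (n * (Complex.I * ((X t * q - Y t * p : ℝ) : ℂ) /
          ((Real.sqrt (X t ^ 2 + Y t ^ 2) : ℝ) : ℂ) ^ 2))) t := by
  have hr : Real.sqrt (X t ^ 2 + Y t ^ 2) ≠ 0 := (Real.sqrt_pos.2 h0).ne'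
  have hR := (hd_r hX hY t h0).ofReal_comp
  have hsq : ((Real.sqrt (X t ^ 2 + Y t ^ 2) : ℝ) : ℂ) ^ 2 = (X t : ℂ) ^ 2 + (Y t : ℂ) ^ 2 := by
    rw [← Complex.ofReal_pow, Real.sq_sqrt h0.le]; push_cast; ring
  have hw : (X t : ℂ) + (Y t : ℂ) * Complex.I ≠ 0 := by
    intro h
    have h1 := congrArg Complex.re h
    have h2 := congrArg Complex.im h
    simp at h1 h2
    simp [h1, h2] at h0
  have hrc : ((Real.sqrt (X t ^ 2 + Y t ^ 2) : ℝ) : ℂ) ≠ 0 := by exact_mod_cast hr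
  have hW := (hX t).ofReal_comp.add ((hY t).ofReal_comp.mul_const Complex.I)
  have hU := hW.div hR hrc
  have hne : ((X t : ℂ) + (Y t : ℂ) * Complex.I) /
        ((Real.sqrt (X t ^ 2 + Y t ^ 2) : ℝ) : ℂ) ≠ 0 := div_ne_zero hw hrc
  have hZ := (hasDerivAt_zpow n _ (Or.inl hne)).comp t hU
  refine hZ.congr_deriv ?_
  simp only [Pi.add_apply]
  rw [zpow_sub_one₀ hne]
  generalize (((X t : ℂ) + (Y t : ℂ) * Complex.I) /
        ((Real.sqrt (X t ^ 2 + Y t ^ 2) : ℝ) : ℂ)) ^ n = E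
  push_cast
  generalize ((Real.sqrt (X t ^ 2 + Y t ^ 2) : ℝ) : ℂ) = r at *
  generalize (X t : ℂ) = x at *
  generalize (Y t : ℂ) = y at *
  field_simp
  rw [hsq]
  linear_combination (E * n * (- y * (x * q - y * p))) * Complex.I_sq

lemma hd_g (n : ℤ) (f : ℝ → ℂ) (hX : ∀ t, HasDerivAt X p t) (hY : ∀ t, HasDerivAt Y q t) (t : ℝ)
    (h0 : 0 < X t ^ 2 + Y t ^ 2) (hf : DifferentiableAt ℝ f (Real.sqrt (X t ^ 2 + Y t ^ 2))) :
    HasDerivAt (fun t => polarSep n f (X t) (Y t))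
      ((((X t : ℂ) + (Y t : ℂ) * Complex.I) /
        ((Real.sqrt (X t ^ 2 + Y t ^ 2) : ℝ) : ℂ)) ^ n *
        (deriv f (Real.sqrt (X t ^ 2 + Y t ^ 2)) * (((p * X t + q * Y t : ℝ) : ℂ) /
            ((Real.sqrt (X t ^ 2 + Y t ^ 2) : ℝ) : ℂ)) +
          f (Real.sqrt (X t ^ 2 + Y t ^ 2)) *
            (n * (Complex.I * ((X t * q - Y t * p : ℝ) : ℂ) /
            ((Real.sqrt (X t ^ 2 + Y t ^ 2) : ℝ) : ℂ) ^ 2)))) t := by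
  have h1 := (hf.hasDerivAt.scomp t (hd_r hX hY t h0)).mul (hd_u n hX hY t h0)
  refine h1.congr_deriv ?_
  simp only [Complex.real_smul, Function.comp]
  push_cast
  ring

lemma hd_g2 (n : ℤ) (f : ℝ → ℂ)
    (hf : ∀ ρ ∈ Set.Ioo (0 : ℝ) 1, DifferentiableAt ℝ f ρ ∧ DifferentiableAt ℝ (deriv f) ρ)
    (hX : ∀ t, HasDerivAt X p t) (hY : ∀ t, HasDerivAt Y q t) (t : ℝ)
    (h0 : 0 < X t ^ 2 + Y t ^ 2) (h1 : X t ^ 2 + Y t ^ 2 < 1)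
    (r : ℝ) (hr : Real.sqrt (X t ^ 2 + Y t ^ 2) = r) :
    iteratedDeriv 2 (fun t => polarSep n f (X t) (Y t)) t =
      (((X t : ℂ) + (Y t : ℂ) * Complex.I) / (r : ℂ)) ^ n *
        (n * (Complex.I * (X t * q - Y t * p) / (r : ℂ) ^ 2) *
          (deriv f r * ((p * X t + q * Y t) / r) +
            f r * (n * (Complex.I * (X t * q - Y t * p) / (r : ℂ) ^ 2))) +
         (deriv (deriv f) r * ((p * X t + q * Y t) / r) ^ 2 +
          deriv f r * ((p ^ 2 + q ^ 2) / r - (p * X t + q * Y t) ^ 2 / r ^ 3) +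
          deriv f r * ((p * X t + q * Y t) / r) *
             (n * (Complex.I * (X t * q - Y t * p) / (r : ℂ) ^ 2)) +
          f r * (n * (Complex.I * (X t * q - Y t * p) *
            (-2 * (p * X t + q * Y t) / (r : ℂ) ^ 4))))) := by
  have cX : Continuous X := continuous_iff_continuousAt.2 fun t => (hX t).continuousAt
  have cY : Continuous Y := continuous_iff_continuousAt.2 fun t => (hY t).continuousAt
  have hmem : ∀ t, 0 < X t ^ 2 + Y t ^ 2 → X t ^ 2 + Y t ^ 2 < 1 →
      Real.sqrt (X t ^ 2 + Y t ^ 2) ∈ Set.Ioo (0 : ℝ) 1 := fun t h0 h1 =>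
    ⟨Real.sqrt_pos.2 h0, by rw [Real.sqrt_lt' one_pos]; simpa using h1⟩
  have e0 : ∀ᶠ t in nhds t, 0 < X t ^ 2 + Y t ^ 2 :=
    (continuous_const.continuousAt).eventually_lt (by fun_prop) h0
  have e1 : ∀ᶠ t in nhds t, X t ^ 2 + Y t ^ 2 < 1 :=
    ContinuousAt.eventually_lt (by fun_prop) (continuous_const.continuousAt) h1
  have hev : deriv (fun t => polarSep n f (X t) (Y t)) =ᶠ[nhds t] fun t =>
      ((((X t : ℂ) + (Y t : ℂ) * Complex.I) /
        ((Real.sqrt (X t ^ 2 + Y t ^ 2) : ℝ) : ℂ)) ^ n *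
        (deriv f (Real.sqrt (X t ^ 2 + Y t ^ 2)) * (((p * X t + q * Y t : ℝ) : ℂ) /
            ((Real.sqrt (X t ^ 2 + Y t ^ 2) : ℝ) : ℂ)) +
          f (Real.sqrt (X t ^ 2 + Y t ^ 2)) *
            (n * (Complex.I * ((X t * q - Y t * p : ℝ) : ℂ) /
            ((Real.sqrt (X t ^ 2 + Y t ^ 2) : ℝ) : ℂ) ^ 2)))) := by
    filter_upwards [e0, e1] with t h0 h1
    exact (hd_g n f hX hY t h0 (hf _ (hmem t h0 h1)).1).deriv
  rw [iteratedDeriv_succ, iteratedDeriv_one, hev.deriv_eq]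
  have hrpos : Real.sqrt (X t ^ 2 + Y t ^ 2) ≠ 0 := (Real.sqrt_pos.2 h0).ne'
  have hrc : ((Real.sqrt (X t ^ 2 + Y t ^ 2) : ℝ) : ℂ) ≠ 0 := by exact_mod_cast hrpos
  have hR := hd_r hX hY t h0
  have hRc := hR.ofReal_comp
  have hS := (((hX t).const_mul p).add ((hY t).const_mul q)).ofReal_comp
  have hK := (((hX t).mul_const q).sub ((hY t).mul_const p)).ofReal_comp
  have hF := (hf _ (hmem t h0 h1)).1.hasDerivAt.scomp t hR
  have hF' := (hf _ (hmem t h0 h1)).2.hasDerivAt.scomp t hR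
  have hD := (hd_u n hX hY t h0).mul ((hF'.mul (hS.div hRc hrc)).add
    (hF.mul (((hK.const_mul Complex.I).div (hRc.pow 2) (pow_ne_zero 2 hrc)).const_mul (n : ℂ))))
  refine hD.deriv.trans ?_
  simp only [Complex.real_smul, Function.comp, Pi.add_apply, Pi.mul_apply, Pi.div_apply,
    Pi.pow_apply, Pi.sub_apply, hr] at hrc ⊢
  generalize (((X t : ℂ) + (Y t : ℂ) * Complex.I) / (r : ℂ)) ^ n = E
  push_cast
  field_simp
  ring

end helpers

/-- for `n ∈ ℤ`, `λ ∈ ℂ` and twice differentiable `f` on `(0,1)`, the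
function `g(x,y) = f(ρ)e^{inσ}` satisfies `((1-x²-y²)/4)Δg + λg = 0` on the punctured
open unit disk if and only if `f` satisfies
`ρ²(1-ρ²)f″ + ρ(1-ρ²)f′ + (4λρ² - n²(1-ρ²))f = 0` on `(0,1)`. -/
theorem statement7 (n : ℤ) (lam : ℂ) (f : ℝ → ℂ)
    (hf : ∀ ρ ∈ Set.Ioo (0 : ℝ) 1, DifferentiableAt ℝ f ρ ∧ DifferentiableAt ℝ (deriv f) ρ) :
    (∀ x y : ℝ, 0 < x ^ 2 + y ^ 2 → x ^ 2 + y ^ 2 < 1 →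
      (((1 - x ^ 2 - y ^ 2) / 4 : ℝ) : ℂ) *
          (iteratedDeriv 2 (fun t : ℝ => polarSep n f t y) x +
           iteratedDeriv 2 (fun t : ℝ => polarSep n f x t) y) +
        lam * polarSep n f x y = 0) ↔
    (∀ ρ ∈ Set.Ioo (0 : ℝ) 1,
      ((ρ ^ 2 * (1 - ρ ^ 2) : ℝ) : ℂ) * deriv (deriv f) ρ +
        ((ρ * (1 - ρ ^ 2) : ℝ) : ℂ) * deriv f ρ +
        (4 * lam * (ρ : ℂ) ^ 2 - (n : ℂ) ^ 2 * (1 - (ρ : ℂ) ^ 2)) * f ρ = 0) := by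
  
  have key : ∀ x y : ℝ, 0 < x ^ 2 + y ^ 2 → x ^ 2 + y ^ 2 < 1 → ∀ r : ℝ,
      Real.sqrt (x ^ 2 + y ^ 2) = r →
      4 * (r : ℂ) ^ 2 * ((((1 - x ^ 2 - y ^ 2) / 4 : ℝ) : ℂ) *
          (iteratedDeriv 2 (fun t : ℝ => polarSep n f t y) x +
           iteratedDeriv 2 (fun t : ℝ => polarSep n f x t) y) +
        lam * polarSep n f x y) = (((x : ℂ) + (y : ℂ) * Complex.I) / (r : ℂ)) ^ n *
      (((r ^ 2 * (1 - r ^ 2) : ℝ) : ℂ) * deriv (deriv f) r +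
        ((r * (1 - r ^ 2) : ℝ) : ℂ) * deriv f r +
        (4 * lam * (r : ℂ) ^ 2 - (n : ℂ) ^ 2 * (1 - (r : ℂ) ^ 2)) * f r) := by
    intro x y h0 h1 r hr
    have a1 := hd_g2 (X := fun t => t) (Y := fun _ => y) n f hf (fun t => hasDerivAt_id t)
      (fun t => hasDerivAt_const t y) x h0 h1 r hr
    have a2 := hd_g2 (X := fun _ => x) (Y := fun t => t) n f hf (fun t => hasDerivAt_const t x)
      (fun t => hasDerivAt_id t) y h0 h1 r hr
    have hrpos : r ≠ 0 := by rw [← hr]; exact (Real.sqrt_pos.2 h0).ne'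
    have hrc : (r : ℂ) ≠ 0 := by exact_mod_cast hrpos
    have hsq : (x : ℂ) ^ 2 = (r : ℂ) ^ 2 - (y : ℂ) ^ 2 := by
      rw [← hr, ← Complex.ofReal_pow (Real.sqrt _), Real.sq_sqrt h0.le]; push_cast; ring
    rw [a1, a2, polarSep, hr]
    generalize (((x : ℂ) + (y : ℂ) * Complex.I) / (r : ℂ)) ^ n = E
    push_cast
    have hI := Complex.I_sq
    generalize (x : ℂ) = x at *
    generalize (y : ℂ) = y at *
    generalize (r : ℂ) = r at *
    generalize Complex.I = i at *
    generalize deriv (deriv f) _ = f2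
    generalize deriv f _ = f1
    generalize f _ = f0
    have hc : 1 - x ^ 2 - y ^ 2 = 1 - r ^ 2 := by rw [hsq]; ring
    rw [hc]
    field_simp
    ring_nf
    simp only [hI, hsq]
    ring
  constructor
  · intro h ρ hρ
    have e : Real.sqrt (ρ ^ 2 + 0 ^ 2) = ρ := by simp [Real.sqrt_sq hρ.1.le]
    have h0 : 0 < ρ ^ 2 + (0 : ℝ) ^ 2 := by have := hρ.1; positivity
    have h1 : ρ ^ 2 + (0 : ℝ) ^ 2 < 1 := by nlinarith [hρ.1, hρ.2]
    have k := key ρ 0 h0 h1 ρ e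
    rw [h ρ 0 h0 h1, mul_zero] at k
    have hρc : (ρ : ℂ) ≠ 0 := by exact_mod_cast hρ.1.ne'
    simpa [div_self hρc] using k.symm
  · intro h x y h0 h1
    have k := key x y h0 h1 _ rfl
    have hm : Real.sqrt (x ^ 2 + y ^ 2) ∈ Set.Ioo (0 : ℝ) 1 :=
      ⟨Real.sqrt_pos.2 h0, by rw [Real.sqrt_lt' one_pos]; simpa using h1⟩
    rw [h _ hm, mul_zero] at k
    have hrc : ((Real.sqrt (x ^ 2 + y ^ 2) : ℝ) : ℂ) ≠ 0 := by exact_mod_cast hm.1.ne'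
    exact (mul_eq_zero.1 k).resolve_left (mul_ne_zero (by norm_num) (pow_ne_zero 2 hrc))
end

section
/- Let n ∈ ℤ and λ ∈ ℂ with λ ≠ 0. Suppose (b_j)_{j≥0} is a sequence of complex numbers, not all zero, such that the power series f(ρ) = Σ_{j=0}^∞ b_j ρ^j has radius of convergence strictly greater than 1, f satisfies ρ²(1-ρ²)f″(ρ) + ρ(1-ρ²)f′(ρ) + (4λρ² - n²(1-ρ²))f(ρ) = 0 for all ρ ∈ (0,1), and f(1) = Σ_{j=0}^∞ b_j = 0. Then λ = ν(|n|+ν) for some integer ν ≥ 1; in particular, λ is a positive integer. -/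
/-- power series with coefficients `b` converges on `|ρ| < R` -/
def PConv (b : ℕ → ℂ) (R : ℝ) : Prop :=
  ∀ ρ : ℝ, |ρ| < R → Summable (fun j : ℕ => b j * (ρ : ℂ) ^ j)

/-- coefficients of the derivative -/
def DCoef (b : ℕ → ℂ) : ℕ → ℂ := fun j => ((j : ℂ) + 1) * b (j + 1)

/-- coefficients of multiplication by the variable -/
def SCoef (b : ℕ → ℂ) : ℕ → ℂ
  | 0 => 0
  | j + 1 => b j

lemma scoef_hasSum {b : ℕ → ℂ} {t s : ℂ} (h : HasSum (fun j => b j * t ^ j) s) :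
    HasSum (fun j => SCoef b j * t ^ j) (t * s) := by
  have h2 : HasSum (fun j => SCoef b (j + 1) * t ^ (j + 1)) (t * s) := by
    refine (h.mul_left t).congr_fun ?_
    intro j
    simp only [SCoef]
    ring
  have := (hasSum_nat_add_iff (f := fun j => SCoef b j * t ^ j) 1).1 h2
  simpa [SCoef] using this

lemma pconv_bound {b : ℕ → ℂ} {R r : ℝ} (h : PConv b R) (hr : 0 < r) (hrR : r < R) :
    ∃ C : ℝ, 0 ≤ C ∧ ∀ j, ‖b j‖ * r ^ j ≤ C := by
  have hs := (h r (by rwa [abs_of_pos hr])).norm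
  refine ⟨∑' j, ‖b j * (r : ℂ) ^ j‖, tsum_nonneg fun _ => norm_nonneg _, fun j => ?_⟩
  have := hs.le_tsum j (fun _ _ => norm_nonneg _)
  simpa [abs_of_pos hr] using this

lemma pconv_dom {b : ℕ → ℂ} {R r : ℝ} (h : PConv b R) (hr : 0 ≤ r) (hrR : r < R) :
    Summable (fun j => ‖DCoef b j‖ * r ^ j) := by
  obtain ⟨r', h1, h2⟩ := exists_between hrR
  have hr' : 0 < r' := lt_of_le_of_lt hr h1
  obtain ⟨C, hC, hb⟩ := pconv_bound h hr' h2
  have hq : ‖r / r'‖ < 1 := by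
    rw [Real.norm_of_nonneg (by positivity), div_lt_one hr']; exact h1
  have hs1 := summable_pow_mul_geometric_of_norm_lt_one 1 hq
  have hs0 := summable_pow_mul_geometric_of_norm_lt_one 0 hq
  have hs := (hs1.add hs0).mul_left (C / r')
  refine Summable.of_nonneg_of_le (fun j => by positivity) (fun j => ?_) hs
  have hn : ‖((j : ℂ) + 1)‖ = (j : ℝ) + 1 := by
    have : ((j : ℂ) + 1) = ((j + 1 : ℕ) : ℂ) := by push_cast; rfl
    rw [this, Complex.norm_natCast]; push_cast; rfl
  have hle : ‖b (j + 1)‖ ≤ C / r' ^ (j + 1) := by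
    rw [le_div_iff₀ (by positivity)]; exact hb _
  rw [DCoef, norm_mul, hn]
  calc ((j : ℝ) + 1) * ‖b (j + 1)‖ * r ^ j ≤ ((j : ℝ) + 1) * (C / r' ^ (j + 1)) * r ^ j := by
        gcongr
    _ = _ := by
        rw [div_pow, pow_succ]; field_simp

lemma pconv_D {b : ℕ → ℂ} {R : ℝ} (h : PConv b R) : PConv (DCoef b) R := by
  intro ρ hρ
  refine Summable.of_norm ?_
  simpa using pconv_dom h (abs_nonneg ρ) hρ

lemma pconv_hasDerivAt {b : ℕ → ℂ} {R : ℝ} (h : PConv b R) {ρ : ℝ} (hρ : |ρ| < R) :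
    HasDerivAt (fun t : ℝ => ∑' j : ℕ, b j * (t : ℂ) ^ j)
      (∑' j : ℕ, DCoef b j * (ρ : ℂ) ^ j) ρ := by
  obtain ⟨r, h1, h2⟩ := exists_between hρ
  have hr : 0 < r := lt_of_le_of_lt (abs_nonneg _) h1
  have hdom := pconv_dom h hr.le h2
  have hdom' : Summable (fun j : ℕ => (j : ℝ) * ‖b j‖ * r ^ (j - 1)) := by
    rw [← summable_nat_add_iff 1]
    refine hdom.congr fun j => ?_
    have hn : ‖((j : ℂ) + 1)‖ = (j : ℝ) + 1 := by
      have : ((j : ℂ) + 1) = ((j + 1 : ℕ) : ℂ) := by push_cast; rfl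
      rw [this, Complex.norm_natCast]; push_cast; rfl
    rw [DCoef, norm_mul, hn]
    push_cast
    simp
  have hder := hasDerivAt_tsum_of_isPreconnected (𝕜 := ℝ) (F := ℂ)
    (g := fun (j : ℕ) (t : ℝ) => b j * (t : ℂ) ^ j)
    (g' := fun (j : ℕ) (t : ℝ) => b j * ((j : ℂ) * (t : ℂ) ^ (j - 1)))
    (t := Set.Ioo (-r) r) (y₀ := 0) (y := ρ) hdom' isOpen_Ioo isPreconnected_Ioo
    (fun j y _ => by
      have := ((hasDerivAt_pow j (y : ℂ)).const_mul (b j)).comp_ofReal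
      simpa using this)
    (fun j y hy => by
      have hy' : |y| ≤ r := abs_le.2 ⟨hy.1.le, hy.2.le⟩
      rw [norm_mul, norm_mul, norm_pow, Complex.norm_natCast, Complex.norm_real, Real.norm_eq_abs]
      have : |y| ^ (j - 1) ≤ r ^ (j - 1) := by gcongr
      calc ‖b j‖ * (j * |y| ^ (j - 1)) ≤ ‖b j‖ * (j * r ^ (j - 1)) := by gcongr
        _ = _ := by ring)
    ⟨by linarith, hr⟩ (h 0 (by simpa using hr.trans h2)) (abs_lt.1 h1)
  suffices key : (∑' j : ℕ, b j * ((j : ℂ) * (ρ : ℂ) ^ (j - 1))) = ∑' j : ℕ, DCoef b j * (ρ : ℂ) ^ j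
    from by rw [← key]; exact hder
  have hs := (pconv_D h) ρ hρ
  have h3 : HasSum (fun j : ℕ => b (j+1) * (((j+1 : ℕ) : ℂ) * (ρ : ℂ) ^ (j + 1 - 1)))
      (∑' j : ℕ, DCoef b j * (ρ : ℂ) ^ j) := by
    refine hs.hasSum.congr_fun fun j => ?_
    simp only [DCoef, Nat.add_sub_cancel]
    push_cast; ring
  have := (hasSum_nat_add_iff
    (f := fun j : ℕ => b j * ((j : ℂ) * (ρ : ℂ) ^ (j - 1))) 1).1 h3
  simpa using this.tsum_eq

lemma uniq_zero {e : ℕ → ℂ}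
    (h : ∀ t ∈ Set.Ioo (0 : ℝ) 1, HasSum (fun j => e j * (t : ℂ) ^ j) 0) : e 0 = 0 := by
  have hp : PConv e 1 := by
    intro ρ hρ
    by_cases h0 : ρ = 0
    · subst h0
      refine summable_of_ne_finset_zero (s := {0}) fun j hj => ?_
      have : j ≠ 0 := by simpa using hj
      simp [this]
    · refine Summable.of_norm ?_
      simpa using (h |ρ| ⟨abs_pos.2 h0, hρ⟩).summable.norm
  have hc := (pconv_hasDerivAt hp (ρ := 0) (by simp)).continuousAt
  have h1 : (∑' j : ℕ, e j * ((0 : ℝ) : ℂ) ^ j) = e 0 := by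
    rw [tsum_eq_single 0]
    · simp
    · intro j hj; simp [hj]
  have hc' : Filter.Tendsto (fun t : ℝ => ∑' j : ℕ, e j * (t : ℂ) ^ j)
      (nhdsWithin 0 (Set.Ioi 0)) (nhds (e 0)) := by
    rw [← h1]; exact hc.tendsto.mono_left nhdsWithin_le_nhds
  refine tendsto_nhds_unique hc' (tendsto_const_nhds.congr' ?_)
  filter_upwards [Ioo_mem_nhdsGT (zero_lt_one (α := ℝ))] with t ht
  exact (h t ht).tsum_eq.symm

lemma uniq_all (j : ℕ) : ∀ {e : ℕ → ℂ},
    (∀ t ∈ Set.Ioo (0 : ℝ) 1, HasSum (fun j => e j * (t : ℂ) ^ j) 0) → e j = 0 := by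
  induction j with
  | zero => intro e h; exact uniq_zero h
  | succ j ih =>
    intro e h
    refine ih (e := fun j => e (j + 1)) fun t ht => ?_
    have h0 := uniq_zero h
    have ht0 : (t : ℂ) ≠ 0 := by exact_mod_cast ht.1.ne'
    have h1 := (hasSum_nat_add_iff (f := fun j => e j * (t : ℂ) ^ j) 1 (g := 0)).2
      (by simpa [h0] using h t ht)
    have h2 := h1.mul_left ((t : ℂ)⁻¹)
    rw [mul_zero] at h2
    refine h2.congr_fun fun j => ?_
    field_simp
    ring

lemma recurrence (n : ℤ) (lam : ℂ) (b : ℕ → ℂ) {R : ℝ} (hR1 : 1 < R) (hR : PConv b R)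
    (hode : ∀ ρ ∈ Set.Ioo (0 : ℝ) 1,
      ((ρ ^ 2 * (1 - ρ ^ 2) : ℝ) : ℂ) *
          deriv (deriv (fun t : ℝ => ∑' j : ℕ, b j * (t : ℂ) ^ j)) ρ +
        ((ρ * (1 - ρ ^ 2) : ℝ) : ℂ) * deriv (fun t : ℝ => ∑' j : ℕ, b j * (t : ℂ) ^ j) ρ +
        (4 * lam * (ρ : ℂ) ^ 2 - (n : ℂ) ^ 2 * (1 - (ρ : ℂ) ^ 2)) *
          (∑' j : ℕ, b j * (ρ : ℂ) ^ j) = 0) (j : ℕ) :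
    ((j : ℂ) ^ 2 - (n : ℂ) ^ 2) * b j +
      SCoef (SCoef fun j => (4 * lam - ((j : ℂ) ^ 2 - (n : ℂ) ^ 2)) * b j) j = 0 := by
  refine uniq_all j (e := fun j => ((j : ℂ) ^ 2 - (n : ℂ) ^ 2) * b j +
      SCoef (SCoef fun j => (4 * lam - ((j : ℂ) ^ 2 - (n : ℂ) ^ 2)) * b j) j) fun t ht => ?_
  have htR : |t| < R := by rw [abs_of_pos ht.1]; exact ht.2.trans hR1
  have hd1 : ∀ s : ℝ, |s| < R → deriv (fun t : ℝ => ∑' j : ℕ, b j * (t : ℂ) ^ j) s =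
      ∑' j : ℕ, DCoef b j * (s : ℂ) ^ j := fun s hs => (pconv_hasDerivAt hR hs).deriv
  have hd2 : deriv (deriv (fun t : ℝ => ∑' j : ℕ, b j * (t : ℂ) ^ j)) t =
      ∑' j : ℕ, DCoef (DCoef b) j * (t : ℂ) ^ j := by
    rw [← (pconv_hasDerivAt (pconv_D hR) htR).deriv]
    refine Filter.EventuallyEq.deriv_eq ?_
    filter_upwards [(isOpen_lt continuous_abs continuous_const).mem_nhds htR] with s hs
    exact hd1 s hs
  have h := hode t ht
  rw [hd2, hd1 t htR] at h
  have s0 := (hR t htR).hasSum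
  have s1 := scoef_hasSum ((pconv_D hR) t htR).hasSum
  have s2 := scoef_hasSum (scoef_hasSum ((pconv_D (pconv_D hR)) t htR).hasSum)
  generalize (∑' j : ℕ, b j * (t : ℂ) ^ j) = F0 at *
  generalize (∑' j : ℕ, DCoef b j * (t : ℂ) ^ j) = F1 at *
  generalize (∑' j : ℕ, DCoef (DCoef b) j * (t : ℂ) ^ j) = F2 at *
  have hA : HasSum (fun j : ℕ => (((j : ℂ) ^ 2 - (n : ℂ) ^ 2) * b j) * (t : ℂ) ^ j)
      (t * (t * F2) + t * F1 - (n : ℂ) ^ 2 * F0) := by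
    refine ((s2.add s1).sub (s0.mul_left ((n : ℂ) ^ 2))).congr_fun fun j => ?_
    rcases j with _ | _ | j
    · simp [SCoef]
    · simp [SCoef, DCoef]; ring
    · simp only [SCoef, DCoef]; push_cast; ring
  have hB := scoef_hasSum (scoef_hasSum (t := (t : ℂ)) (b := fun j => (4 * lam - ((j : ℂ) ^ 2 - (n : ℂ) ^ 2)) * b j)
    (((s0.mul_left (4 * lam)).sub hA).congr_fun fun j => by ring))
  have hAB := hA.add hB
  have hz : (t * (t * F2) + t * F1 - (n : ℂ) ^ 2 * F0) + (t : ℂ) * (t * (4 * lam * F0 -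
      (t * (t * F2) + t * F1 - (n : ℂ) ^ 2 * F0))) = 0 := by
    rw [← h]; push_cast; ring
  rw [hz] at hAB
  refine hAB.congr_fun fun j => by ring

/-- let `n ∈ ℤ`, `λ ∈ ℂ` with `λ ≠ 0`, and let `(b_j)` be a not-identically-zero
sequence such that the power series `f(ρ) = Σ_j b_j ρ^j` has radius of convergence `> 1`,
`f` satisfies `ρ²(1-ρ²)f″ + ρ(1-ρ²)f′ + (4λρ² - n²(1-ρ²))f = 0` on `(0,1)`, and
`f(1) = Σ_j b_j = 0`.  Then `λ = ν(|n|+ν)` for some integer `ν ≥ 1` (in particular `λ` is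
a positive integer). -/
theorem statement11 (n : ℤ) (lam : ℂ) (hlam : lam ≠ 0) (b : ℕ → ℂ)
    (hb : ∃ j, b j ≠ 0)
    (hR : ∃ R : ℝ, 1 < R ∧ ∀ ρ : ℝ, |ρ| < R → Summable (fun j : ℕ => b j * (ρ : ℂ) ^ j))
    (hode : ∀ ρ ∈ Set.Ioo (0 : ℝ) 1,
      ((ρ ^ 2 * (1 - ρ ^ 2) : ℝ) : ℂ) *
          deriv (deriv (fun t : ℝ => ∑' j : ℕ, b j * (t : ℂ) ^ j)) ρ +
        ((ρ * (1 - ρ ^ 2) : ℝ) : ℂ) * deriv (fun t : ℝ => ∑' j : ℕ, b j * (t : ℂ) ^ j) ρ +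
        (4 * lam * (ρ : ℂ) ^ 2 - (n : ℂ) ^ 2 * (1 - (ρ : ℂ) ^ 2)) *
          (∑' j : ℕ, b j * (ρ : ℂ) ^ j) = 0)
    (hboundary : (∑' j : ℕ, b j) = 0) :
    ∃ ν : ℕ, 1 ≤ ν ∧ lam = (ν : ℂ) * ((n.natAbs : ℂ) + (ν : ℂ)) := by
  obtain ⟨R, hR1, hR⟩ := hR
  have hrec := recurrence n lam b hR1 hR hode
  have hrec2 : ∀ j : ℕ, (((j + 2 : ℕ) : ℂ) ^ 2 - (n : ℂ) ^ 2) * b (j + 2) =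
      (((j : ℂ) ^ 2 - (n : ℂ) ^ 2) - 4 * lam) * b j := by
    intro j
    have := hrec (j + 2)
    simp only [SCoef] at this
    linear_combination this
  have hn2 : (n : ℂ) ^ 2 = (n.natAbs : ℂ) ^ 2 := by
    have : (n : ℤ) ^ 2 = ((n.natAbs : ℤ)) ^ 2 := (Int.natAbs_sq n).symm
    have h2 := congrArg (Int.cast : ℤ → ℂ) this
    push_cast [-Int.natCast_natAbs] at h2
    exact h2
  generalize n.natAbs = N at *
  rw [hn2] at hrec2 hrec
  -- the first nonzero coefficient has index N
  have hN : b N ≠ 0 := by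
    classical
    have hm := Nat.find_spec hb
    have hmin : ∀ i < Nat.find hb, b i = 0 := fun i hi => by
      simpa using Nat.find_min hb hi
    generalize Nat.find hb = m at *
    have hmm : ((m : ℂ) ^ 2 - (N : ℂ) ^ 2) * b m = 0 := by
      rcases m with _ | _ | m
      · simpa [SCoef] using hrec 0
      · simpa [SCoef] using hrec 1
      · rw [hrec2 m, hmin m (by omega), mul_zero]
    have h1 : (m : ℂ) ^ 2 = (N : ℂ) ^ 2 := by
      have := (mul_eq_zero.1 hmm).resolve_right hm
      linear_combination this
    have h2 : m ^ 2 = N ^ 2 := by exact_mod_cast h1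
    have h3 : m = N := Nat.pow_left_injective (n := 2) (by norm_num) h2
    rwa [← h3]
  by_contra hcon
  push Not at hcon
  have hc : ∀ k : ℕ, ((k : ℂ) + 1) * ((N : ℂ) + k + 1) * b (N + 2 * (k + 1)) =
      ((k : ℂ) * (N + k) - lam) * b (N + 2 * k) := by
    intro k
    have := hrec2 (N + 2 * k)
    rw [show N + 2 * (k + 1) = N + 2 * k + 2 by ring]
    push_cast at this
    linear_combination this / 4
  have hfac : ∀ k : ℕ, ((k : ℂ) * (N + k) - lam) ≠ 0 := by
    intro k hk
    rcases Nat.eq_zero_or_pos k with h | h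
    · subst h; apply hlam; simpa using hk
    · exact hcon k h (by linear_combination -hk)
  have hne : ∀ k : ℕ, b (N + 2 * k) ≠ 0 := by
    intro k
    induction k with
    | zero => simpa using hN
    | succ k ih =>
      intro h0
      have := hc k
      rw [h0, mul_zero] at this
      exact mul_ne_zero (hfac k) ih this.symm
  obtain ⟨r, hr1, hr2⟩ := exists_between hR1
  have hr0 : 0 < r := by linarith
  have hs := hR r (by rwa [abs_of_pos hr0])
  have hs2 : Summable (fun k : ℕ => b (N + 2 * k) * (r : ℂ) ^ (N + 2 * k)) :=
    hs.comp_injective (i := fun k : ℕ => N + 2 * k) (fun a c h => by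
      simp only at h; omega)
  refine not_summable_of_ratio_test_tendsto_gt_one (l := r ^ 2) (by nlinarith) ?_ hs2
  have hratio : ∀ k : ℕ, ‖b (N + 2 * (k + 1)) * (r : ℂ) ^ (N + 2 * (k + 1))‖ /
      ‖b (N + 2 * k) * (r : ℂ) ^ (N + 2 * k)‖ =
      ‖((k : ℂ) / (k + 1)) * (1 - 1 / ((N : ℂ) + 1 + k)) - lam * (1 / ((k : ℂ) + 1)) * (1 / ((N : ℂ) + 1 + k))‖ * r ^ 2 := by
    intro k
    have hk1 : (k : ℂ) + 1 ≠ 0 := by exact_mod_cast Nat.succ_ne_zero k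
    have hk2 : (N : ℂ) + 1 + k ≠ 0 := by
      have : N + 1 + k ≠ 0 := by omega
      exact_mod_cast this
    have hrc : (r : ℂ) ≠ 0 := by exact_mod_cast hr0.ne'
    have hrn : r ^ 2 = ‖(r : ℂ) ^ 2‖ := by simp
    rw [← norm_div, hrn, ← norm_mul]
    congr 1
    rw [div_eq_iff (mul_ne_zero (hne k) (pow_ne_zero _ hrc))]
    have := hc k
    have hb' : b (N + 2 * (k + 1)) = ((k : ℂ) * (N + k) - lam) * b (N + 2 * k) / (((k : ℂ) + 1) * ((N : ℂ) + 1 + k)) := by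
      rw [eq_div_iff (mul_ne_zero hk1 hk2)]
      linear_combination this
    rw [hb', show N + 2 * (k + 1) = N + 2 * k + 2 by ring, pow_add]
    field_simp
    ring
  simp_rw [hratio]
  have t1 : Filter.Tendsto (fun k : ℕ => (1 : ℂ) / ((k : ℂ) + 1)) Filter.atTop (nhds 0) :=
    tendsto_one_div_add_atTop_nhds_zero_nat (𝕜 := ℂ)
  have t2 : Filter.Tendsto (fun k : ℕ => (1 : ℂ) / ((N : ℂ) + 1 + k)) Filter.atTop (nhds 0) := by
    have := t1.comp (Filter.tendsto_add_atTop_nat N)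
    refine this.congr fun k => ?_
    simp only [Function.comp]
    push_cast
    congr 1; ring
  have t3 : Filter.Tendsto (fun k : ℕ => (k : ℂ) / ((k : ℂ) + 1)) Filter.atTop (nhds 1) := by
    have := t1.const_sub 1
    rw [sub_zero] at this
    refine this.congr fun k => ?_
    have hk1 : (k : ℂ) + 1 ≠ 0 := by exact_mod_cast Nat.succ_ne_zero k
    field_simp; ring
  have t4 := (((t3.mul (t2.const_sub 1)).sub ((t1.const_mul lam).mul t2)).norm).mul_const (r ^ 2)
  simpa using t4
end
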